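/- (ADer(V), ∧, [·,·]^{NR}) is a Gerstenhaber algebra: for all multiderivations X ∈ ADer^x(V), Y ∈ ADer^y(V), Z ∈ ADer^z(V), the graded Leibniz rule [X, Y∧Z]^{NR} = [X,Y]^{NR}∧Z + (−1)^{x(y+1)} Y∧[X,Z]^{NR} holds. -/

import Mathlib

/-!  Common framework: operations of degree `a ≥ -1` on a vector space `V`
(i.e. `(a+1)`-linear maps `V^{a+1} → V`) are encoded as raw functions
`(ℕ → V) → V` depending only on the first `a+1` entries of the argument
sequence, together with explicit multilinearity/alternation predicates. -/

noncomputable section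
open scoped Classical

namespace JacobiRevisited

/-- Raw operations on `V`: an `n`-ary operation is encoded by its action on
infinite sequences of arguments (using only the first `n` of them). -/
abbrev Op (V : Type*) := (ℕ → V) → V

/-- `A` depends only on the first `n` arguments. -/
def DependsOn {V : Type*} (n : ℕ) (A : Op V) : Prop :=
  ∀ x y : ℕ → V, (∀ i, i < n → x i = y i) → A x = A y

/-- `A` is an `n`-linear map `V^n → V` (encoded on sequences): it depends only on
the first `n` arguments and is `k`-linear in each of them. -/
def IsMultilinearOn (k : Type*) {V : Type*} [Semiring k] [AddCommMonoid V]
    [Module k V] (n : ℕ) (A : Op V) : Prop :=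
  DependsOn n A ∧
    ∀ i, i < n →
      (∀ (x : ℕ → V) (c : k) (v : V),
        A (Function.update x i (c • v)) = c • A (Function.update x i v)) ∧
      (∀ (x : ℕ → V) (v w : V),
        A (Function.update x i (v + w)) =
          A (Function.update x i v) + A (Function.update x i w))

/-- `A` is alternating in its first `n` arguments. -/
def IsAlternatingOn {V : Type*} [Zero V] (n : ℕ) (A : Op V) : Prop :=
  ∀ x : ℕ → V, ∀ i j, i < n → j < n → i ≠ j → x i = x j → A x = 0

/-- The number of arguments of an operation of degree `a` (namely `a+1`). -/
def ar (a : ℤ) : ℕ := (a + 1).toNat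

/-- Membership in `M^a(V)`: an `(a+1)`-linear map `V^{a+1} → V`
(for `a = -1` this is just a constant, i.e. an element of `V`). -/
def MemM (k : Type*) {V : Type*} [Semiring k] [AddCommMonoid V] [Module k V]
    (a : ℤ) (A : Op V) : Prop := IsMultilinearOn k (ar a) A

/-- Membership in `A^a(V)`: an alternating `(a+1)`-linear map `V^{a+1} → V`. -/
def MemA (k : Type*) {V : Type*} [Semiring k] [AddCommMonoid V] [Module k V]
    (a : ℤ) (A : Op V) : Prop :=
  IsMultilinearOn k (ar a) A ∧ IsAlternatingOn (ar a) A

/-- The argument sequence `x_0, …, x_{m-1}, B(x_m,…,x_{m+nB-1}), x_{m+nB}, …`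
(arguments for the outer operation after inserting the `nB`-ary `B`
at slot `m`). -/
def insertArg {V : Type*} (B : Op V) (nB m : ℕ) (x : ℕ → V) : ℕ → V := fun j =>
  if j < m then x j
  else if j = m then B fun i => x (m + i)
  else x (j + nB - 1)

/-- The Gerstenhaber insertion `ι_B A` of `B ∈ M^b(V)` into `A ∈ M^a(V)`:
`ι_B A(x_0,…,x_{a+b}) = Σ_{m=0}^{a} (−1)^{b·m} A(x_0,…,x_{m−1},
B(x_m,…,x_{m+b}), x_{m+b+1},…,x_{a+b})`. -/
def gIns {V : Type*} [AddCommGroup V] (a b : ℤ) (A B : Op V) : Op V := fun x =>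
  ∑ m ∈ Finset.range (ar a),
    (((-1 : ℤˣ) ^ (b * (m : ℤ)) : ℤˣ) : ℤ) • A (insertArg B (ar b) m x)

/-- The Gerstenhaber bracket `[A,B]^G = −ι_A B + (−1)^{ab} ι_B A` of
`A ∈ M^a(V)` and `B ∈ M^b(V)`. -/
def gBracket {V : Type*} [AddCommGroup V] (a b : ℤ) (A B : Op V) : Op V :=
  -(gIns b a B A) + (((-1 : ℤˣ) ^ (a * b) : ℤˣ) : ℤ) • gIns a b A B

/-- The set `S(n-1, p-1)` of unshuffle permutations of `{0,…,n-1}` which are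
strictly increasing on the first `p` positions and on the remaining ones. -/
def Unshuffles (n p : ℕ) : Finset (Equiv.Perm (Fin n)) :=
  Finset.univ.filter fun σ =>
    (∀ i j : Fin n, (i : ℕ) < (j : ℕ) → (j : ℕ) < p → σ i < σ j) ∧
    (∀ i j : Fin n, (i : ℕ) < (j : ℕ) → p ≤ (i : ℕ) → σ i < σ j)

/-- The Nijenhuis–Richardson insertion `i_B A` of the `nB`-ary `B` into the
`nA`-ary `A`:
`i_B A(x_0,…,x_{a+b}) = Σ_{σ ∈ S(a+b,b)} sgn(σ) ·
A(B(x_{σ(0)},…,x_{σ(b)}), x_{σ(b+1)},…,x_{σ(a+b)})`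
(and `i_B A = 0` when `A` has degree `-1`, i.e. no argument slots). -/
def nrIns {V : Type*} [AddCommGroup V] (nA nB : ℕ) (A B : Op V) : Op V := fun x =>
  if hA : nA = 0 then 0
  else
    ∑ σ ∈ Unshuffles (nA + nB - 1) nB,
      ((Equiv.Perm.sign σ : ℤˣ) : ℤ) •
        A fun j =>
          if hj0 : j = 0 then
            B fun i => if hi : i < nB then x (σ ⟨i, by omega⟩) else 0
          else if hj : j < nA then x (σ ⟨nB + j - 1, by omega⟩) else 0

/-- The Nijenhuis–Richardson bracket `[A,B]^{NR} = −i_A B + (−1)^{ab} i_B A`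
of `A ∈ A^a(V)` and `B ∈ A^b(V)`. -/
def nrBracket {V : Type*} [AddCommGroup V] (a b : ℤ) (A B : Op V) : Op V :=
  -(nrIns (ar b) (ar a) B A) +
    (((-1 : ℤˣ) ^ (a * b) : ℤˣ) : ℤ) • nrIns (ar a) (ar b) A B

/-- The wedge product `A∧B` of the `nA`-ary `A` and the `nB`-ary `B`
(over a commutative algebra `V`):
`(A∧B)(x_0,…,x_{a+b+1}) = Σ_σ sgn(σ) · A(x_{σ(0)},…,x_{σ(a)}) ·
B(x_{σ(a+1)},…,x_{σ(a+b+1)})` summed over unshuffles. -/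
def wedge {V : Type*} [CommRing V] (nA nB : ℕ) (A B : Op V) : Op V := fun x =>
  ∑ σ ∈ Unshuffles (nA + nB) nA,
    ((Equiv.Perm.sign σ : ℤˣ) : ℤ) •
      (A (fun i => if hi : i < nA then x (σ ⟨i, by omega⟩) else 0) *
        B fun j => if hj : j < nB then x (σ ⟨nA + j, by omega⟩) else 0)

/-- The argument sequence `v, x_0, x_1, …`. -/
def consV {V : Type*} (v : V) (x : ℕ → V) : ℕ → V := fun n =>
  if n = 0 then v else x (n - 1)

/-- The argument sequence `v, w, 0, 0, …` (for applying binary operations). -/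
def duo {V : Type*} [Zero V] (v w : V) : ℕ → V := fun n =>
  if n = 0 then v else if n = 1 then w else 0

/-- Membership in `ADer^a(V)`: an alternating `(a+1)`-linear map which (for
`a ≥ 0`) is a derivation in its first (hence, by skew-symmetry, in each)
argument; `ADer^{-1}(V) = V`. -/
def MemADer (k : Type*) {V : Type*} [CommRing k] [CommRing V] [Algebra k V]
    (a : ℤ) (A : Op V) : Prop :=
  IsMultilinearOn k (ar a) A ∧ IsAlternatingOn (ar a) A ∧
    (0 ≤ a → ∀ (f g : V) (x : ℕ → V),
      A (consV (f * g) x) = f * A (consV g x) + g * A (consV f x))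

/-- Membership in `ADiff_1^a(V)`: an alternating `(a+1)`-linear map which (for
`a ≥ 0`) is a first-order differential operator in its first (hence in each)
argument; `ADiff_1^{-1}(V) = V`. -/
def MemADiff1 (k : Type*) {V : Type*} [CommRing k] [CommRing V] [Algebra k V]
    (a : ℤ) (A : Op V) : Prop :=
  IsMultilinearOn k (ar a) A ∧ IsAlternatingOn (ar a) A ∧
    (0 ≤ a → ∀ (f g : V) (x : ℕ → V),
      A (consV (f * g) x) =
        f * A (consV g x) + g * A (consV f x) - f * g * A (consV 1 x))

/-- `D : V → V` is a differential operator of order `≤ n` on the commutative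
algebra `V`. -/
def DiffOrderLe {V : Type*} [CommRing V] : ℕ → (V → V) → Prop
  | 0 => fun D => ∀ f x, D (f * x) = f * D x
  | n + 1 => fun D => ∀ f : V, DiffOrderLe n fun x => D (f * x) - f * D x

/-- Membership in `ADiff^a(V)`: an alternating `(a+1)`-linear map which is a
differential operator of some finite order in each argument separately
(the other arguments being fixed); `ADiff^{-1}(V) = V`. -/
def MemADiff (k : Type*) {V : Type*} [CommRing k] [CommRing V] [Algebra k V]
    (a : ℤ) (A : Op V) : Prop :=
  IsMultilinearOn k (ar a) A ∧ IsAlternatingOn (ar a) A ∧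
    ∀ i, i < ar a → ∃ n, ∀ x : ℕ → V,
      DiffOrderLe n fun v => A (Function.update x i v)

/-- The identity map `I ∈ A^0(V)`. -/
def Iop {V : Type*} : Op V := fun x => x 0

/-- The insertion `i_1 A` of the unit `1 ∈ V = A^{-1}(V)` into `A ∈ A^a(V)`;
for `a ≥ 0` this is `A(1,·,…,·)`. -/
def iUnit {V : Type*} [CommRing V] (a : ℤ) (A : Op V) : Op V :=
  nrIns (ar a) 0 A fun _ => 1

/-- Application of a degree-0 (i.e. unary) operation to an element of `V`. -/
def app1 {V : Type*} (X : Op V) (v : V) : V := X fun _ => v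

/-- The commutator `X∘Y − Y∘X` of two degree-0 operations. -/
def commOp {V : Type*} [AddCommGroup V] (X Y : Op V) : Op V := fun x =>
  app1 X (app1 Y (x 0)) - app1 Y (app1 X (x 0))

/-- The iterated wedge product `X_1 ∧ … ∧ X_m` of a list of degree-0
operations (with the empty product being the unit `1 ∈ V = A^{-1}(V)`). -/
def wedgeList {V : Type*} [CommRing V] : List (Op V) → Op V
  | [] => fun _ => 1
  | X :: l => wedge 1 l.length X (wedgeList l)


/-! ### Signed unshuffles of lists -/

/-- The sum of `± m s t` over all ways to split the list into complementary subsequences `s` and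
`t`, weighted by the sign of the corresponding unshuffle. -/
def unshuffleSum {V : Type*} [CommRing V] : List V → (List V → List V → V) → V
  | [], m => m [] []
  | v :: l, m => unshuffleSum l (fun s t => m (v :: s) t) +
      unshuffleSum l (fun s t => (-1) ^ s.length * m s (v :: t))

section UnshuffleSum

variable {V : Type*} [CommRing V]

theorem unshuffleSum_congr (l : List V) {m m' : List V → List V → V}
    (h : ∀ s t, s.length + t.length = l.length → m s t = m' s t) :
    unshuffleSum l m = unshuffleSum l m' := by
  induction l generalizing m m' with
  | nil => exact h [] [] rfl
  | cons v l ih =>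
    simp only [unshuffleSum]
    congr 1
    · exact ih fun s t hst => h _ _ (by simp only [List.length_cons]; omega)
    · exact ih fun s t hst => by rw [h _ _ (by simp only [List.length_cons]; omega)]

/-- An additive map commutes with the sum over unshuffles. -/
theorem map_unshuffleSum (φ : V →+ V) (l : List V) (m : List V → List V → V) :
    φ (unshuffleSum l m) = unshuffleSum l fun s t => φ (m s t) := by
  induction l generalizing m with
  | nil => rfl
  | cons v l ih =>
    simp only [unshuffleSum, map_add, ih]
    congr 2
    funext s t
    rcases neg_one_pow_eq_or V s.length with h | h <;> simp [h]

theorem unshuffleSum_add (l : List V) (m m' : List V → List V → V) :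
    unshuffleSum l (fun s t => m s t + m' s t) = unshuffleSum l m + unshuffleSum l m' := by
  induction l generalizing m m' with
  | nil => rfl
  | cons v l ih =>
    simp only [unshuffleSum, mul_add, ih]
    ring

theorem mul_unshuffleSum (c : V) (l : List V) (m : List V → List V → V) :
    c * unshuffleSum l m = unshuffleSum l fun s t => c * m s t :=
  map_unshuffleSum (AddMonoidHom.mulLeft c) l m

theorem unshuffleSum_mul (c : V) (l : List V) (m : List V → List V → V) :
    unshuffleSum l m * c = unshuffleSum l fun s t => m s t * c :=
  map_unshuffleSum (AddMonoidHom.mulRight c) l m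

theorem unshuffleSum_eq_zero (l : List V) {m : List V → List V → V}
    (h : ∀ s t, s.length + t.length = l.length → m s t = 0) : unshuffleSum l m = 0 := by
  rw [unshuffleSum_congr l h]
  simpa using (mul_unshuffleSum (0 : V) l fun _ _ => 0).symm

/-- Graded cocommutativity of the unshuffle coproduct. -/
theorem unshuffleSum_comm (l : List V) (m : List V → List V → V) :
    unshuffleSum l (fun s t => (-1) ^ (s.length * t.length) * m t s) = unshuffleSum l m := by
  induction l generalizing m with
  | nil => simp [unshuffleSum]
  | cons v l ih =>
    simp only [unshuffleSum]
    rw [add_comm, ← ih fun s t => m (v :: s) t, ← ih fun s t => (-1) ^ s.length * m s (v :: t)]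
    congr 2
    · funext s t
      rw [← mul_assoc, ← pow_add, List.length_cons]
      rw [show s.length + s.length * (t.length + 1) = 2 * s.length + s.length * t.length by ring,
        pow_add, pow_mul (-1 : V) 2]
      simp
    · funext s t
      rw [← mul_assoc, ← pow_add, List.length_cons]
      ring_nf

/-- Coassociativity of the unshuffle coproduct. -/
theorem unshuffleSum_assoc (l : List V) (m : List V → List V → List V → V) :
    unshuffleSum l (fun s t => unshuffleSum s fun s₁ s₂ => m s₁ s₂ t) =
      unshuffleSum l (fun s t => unshuffleSum t fun t₁ t₂ => m s t₁ t₂) := by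
  induction l generalizing m with
  | nil => rfl
  | cons v l ih =>
    simp only [unshuffleSum, unshuffleSum_add, mul_add, mul_unshuffleSum]
    rw [ih fun a b c => m (v :: a) b c, ih fun a b c => (-1) ^ a.length * m a (v :: b) c,
      add_assoc]
    congr 2
    have h : ∀ s t, unshuffleSum s (fun s₁ s₂ => (-1) ^ s.length * m s₁ s₂ (v :: t)) =
        unshuffleSum s fun s₁ s₂ => (-1) ^ s₁.length * ((-1) ^ s₂.length * m s₁ s₂ (v :: t)) :=
      fun s t => unshuffleSum_congr s fun s₁ s₂ hs => by rw [← hs, pow_add, mul_assoc]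
    simp only [h]
    exact ih fun a b c => (-1) ^ a.length * ((-1) ^ b.length * m a b (v :: c))

end UnshuffleSum

/-! ### Unshuffle permutations -/

/-- The permutation of `Fin (n + 1)` sending `i` to `0` and acting as `τ` on the other points. -/
def insertPerm {n : ℕ} (i : Fin (n + 1)) (τ : Equiv.Perm (Fin n)) : Equiv.Perm (Fin (n + 1)) :=
  Equiv.Perm.decomposeFin.symm (0, τ) * i.cycleRange

section Unshuffles

variable {n : ℕ}

@[simp] theorem insertPerm_self (i : Fin (n + 1)) (τ : Equiv.Perm (Fin n)) :
    insertPerm i τ i = 0 := by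
  simp [insertPerm]

@[simp] theorem insertPerm_succAbove (i : Fin (n + 1)) (τ : Equiv.Perm (Fin n)) (j : Fin n) :
    insertPerm i τ (i.succAbove j) = (τ j).succ := by
  simp [insertPerm, Fin.cycleRange_succAbove]

theorem sign_insertPerm (i : Fin (n + 1)) (τ : Equiv.Perm (Fin n)) :
    Equiv.Perm.sign (insertPerm i τ) = (-1) ^ (i : ℕ) * Equiv.Perm.sign τ := by
  simp [insertPerm, Equiv.Perm.decomposeFin.symm_sign, mul_comm]

theorem insertPerm_bijective :
    Function.Bijective fun q : Fin (n + 1) × Equiv.Perm (Fin n) => insertPerm q.1 q.2 := by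
  rw [Fintype.bijective_iff_injective_and_card]
  refine ⟨?_, by simp [Fintype.card_perm, Nat.factorial_succ]⟩
  rintro ⟨i, τ⟩ ⟨i', τ'⟩ h
  dsimp only at h
  obtain rfl : i = i' := (insertPerm i' τ').injective (by rw [insertPerm_self, ← h, insertPerm_self])
  have : τ = τ' := Equiv.ext fun j => Fin.succ_injective _ (by
    rw [← insertPerm_succAbove i, ← insertPerm_succAbove i, h])
  rw [this]

theorem sum_perm_succ {M : Type*} [AddCommMonoid M] (G : Equiv.Perm (Fin (n + 1)) → M) :
    ∑ σ, G σ = ∑ i, ∑ τ : Equiv.Perm (Fin n), G (insertPerm i τ) := by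
  rw [← Fintype.sum_prod_type', ← insertPerm_bijective.sum_comp]

theorem mem_unshuffles {p : ℕ} {σ : Equiv.Perm (Fin n)} :
    σ ∈ Unshuffles n p ↔
      (∀ i j : Fin n, (i : ℕ) < (j : ℕ) → (j : ℕ) < p → σ i < σ j) ∧
      (∀ i j : Fin n, (i : ℕ) < (j : ℕ) → p ≤ (i : ℕ) → σ i < σ j) := by
  simp [Unshuffles]

theorem val_succAbove (i : Fin (n + 1)) (j : Fin n) :
    (i.succAbove j : ℕ) = if (j : ℕ) < i then (j : ℕ) else j + 1 := by
  simp only [Fin.succAbove, Fin.lt_def]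
  split_ifs <;> simp_all

theorem insertPerm_zero_mem_unshuffles {p : ℕ} {τ : Equiv.Perm (Fin n)} :
    insertPerm 0 τ ∈ Unshuffles (n + 1) (p + 1) ↔ τ ∈ Unshuffles n p := by
  have h0 : insertPerm 0 τ 0 = 0 := insertPerm_self 0 τ
  have hs : ∀ j : Fin n, insertPerm 0 τ j.succ = (τ j).succ := fun j => by
    rw [← Fin.succAbove_zero_apply, insertPerm_succAbove]
  simp only [mem_unshuffles, Fin.forall_fin_succ (n := n), h0, hs, Fin.val_succ, Fin.val_zero,
    Fin.succ_lt_succ_iff]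
  simp

theorem insertPerm_mem_unshuffles {i : Fin (n + 1)} {τ : Equiv.Perm (Fin n)} :
    insertPerm i τ ∈ Unshuffles (n + 1) i ↔ τ ∈ Unshuffles n i := by
  simp only [mem_unshuffles, Fin.forall_iff_succAbove i, insertPerm_self, insertPerm_succAbove,
    Fin.succ_lt_succ_iff, val_succAbove]
  grind

theorem eq_of_insertPerm_mem_unshuffles {p : ℕ} {i : Fin (n + 1)}
    {τ : Equiv.Perm (Fin n)} (h : insertPerm i τ ∈ Unshuffles (n + 1) p) :
    (i : ℕ) = p ∨ i = 0 ∧ 0 < p := by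
  rw [mem_unshuffles] at h
  by_contra! hi
  rcases lt_or_ge (i : ℕ) p with hip | hip
  · have := h.1 0 i (by have := mt (Fin.ext (a := i) (b := 0)); grind) hip
    simp at this
  · have := h.2 ⟨p, by omega⟩ i (by grind) le_rfl
    simp at this

theorem take_ofFn_insertPerm {α : Type*} (a : Fin (n + 1) → α) (i : Fin (n + 1))
    (τ : Equiv.Perm (Fin n)) :
    (List.ofFn (a ∘ insertPerm i τ)).take i = (List.ofFn ((a ∘ Fin.succ) ∘ τ)).take i := by
  refine List.ext_getElem (by simp; omega) fun j h₁ h₂ => ?_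
  simp only [List.length_take, List.length_ofFn, lt_min_iff] at h₁ h₂
  have : (⟨j, h₁.2⟩ : Fin (n + 1)) = i.succAbove ⟨j, h₂.2⟩ :=
    Fin.ext (by simp [val_succAbove, h₁.1])
  simp [this, -List.ofFn_succ]

theorem drop_ofFn_insertPerm {α : Type*} (a : Fin (n + 1) → α) (i : Fin (n + 1))
    (τ : Equiv.Perm (Fin n)) :
    (List.ofFn (a ∘ insertPerm i τ)).drop i =
      a 0 :: (List.ofFn ((a ∘ Fin.succ) ∘ τ)).drop i := by
  refine List.ext_getElem (by simp; omega) fun j h₁ h₂ => ?_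
  simp only [List.length_drop, List.length_ofFn] at h₁
  rcases j with _ | j
  · simp [-List.ofFn_succ]
  · have : (⟨i + (j + 1), by omega⟩ : Fin (n + 1)) = i.succAbove ⟨i + j, by omega⟩ :=
      Fin.ext (by simp [val_succAbove, add_assoc])
    simp [this, -List.ofFn_succ]

theorem sum_unshuffles_insertPerm_zero {V : Type*} [CommRing V] (n p : ℕ) (a : Fin (n + 1) → V)
    (m : List V → List V → V) :
    (∑ τ : Equiv.Perm (Fin n), if insertPerm 0 τ ∈ Unshuffles (n + 1) (p + 1) then
      ((Equiv.Perm.sign (insertPerm 0 τ) : ℤˣ) : ℤ) •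
        m ((List.ofFn (a ∘ insertPerm 0 τ)).take (p + 1))
          ((List.ofFn (a ∘ insertPerm 0 τ)).drop (p + 1)) else 0) =
      ∑ τ ∈ Unshuffles n p, ((Equiv.Perm.sign τ : ℤˣ) : ℤ) •
        m (a 0 :: (List.ofFn ((a ∘ Fin.succ) ∘ τ)).take p)
          ((List.ofFn ((a ∘ Fin.succ) ∘ τ)).drop p) := by
  simp only [insertPerm_zero_mem_unshuffles, Finset.sum_ite_mem, Finset.univ_inter]
  refine Finset.sum_congr rfl fun τ _ => ?_
  have h := drop_ofFn_insertPerm a 0 τ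
  simp only [Fin.val_zero, List.drop_zero] at h
  simp [h, sign_insertPerm, -List.ofFn_succ]

theorem sum_unshuffles_insertPerm {V : Type*} [CommRing V] {n : ℕ} (i : Fin (n + 1))
    (a : Fin (n + 1) → V) (m : List V → List V → V) :
    (∑ τ : Equiv.Perm (Fin n), if insertPerm i τ ∈ Unshuffles (n + 1) i then
      ((Equiv.Perm.sign (insertPerm i τ) : ℤˣ) : ℤ) •
        m ((List.ofFn (a ∘ insertPerm i τ)).take i)
          ((List.ofFn (a ∘ insertPerm i τ)).drop i) else 0) =
      ∑ τ ∈ Unshuffles n i, ((Equiv.Perm.sign τ : ℤˣ) : ℤ) •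
        ((-1) ^ (i : ℕ) * m ((List.ofFn ((a ∘ Fin.succ) ∘ τ)).take i)
          (a 0 :: (List.ofFn ((a ∘ Fin.succ) ∘ τ)).drop i)) := by
  simp only [insertPerm_mem_unshuffles, Finset.sum_ite_mem, Finset.univ_inter]
  refine Finset.sum_congr rfl fun τ _ => ?_
  rw [take_ofFn_insertPerm, drop_ofFn_insertPerm, sign_insertPerm]
  simp only [zsmul_eq_mul]
  push_cast
  ring

theorem sum_unshuffles {V : Type*} [CommRing V] (n p : ℕ) (hp : p ≤ n) (a : Fin n → V)
    (m : List V → List V → V) :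
    ∑ σ ∈ Unshuffles n p, ((Equiv.Perm.sign σ : ℤˣ) : ℤ) •
        m ((List.ofFn (a ∘ σ)).take p) ((List.ofFn (a ∘ σ)).drop p) =
      unshuffleSum (List.ofFn a) fun s t => if s.length = p then m s t else 0 := by
  induction n generalizing p m with
  | zero =>
    obtain rfl : p = 0 := by omega
    have : Unshuffles 0 0 = {1} := by ext σ; simp [mem_unshuffles, Subsingleton.elim σ 1]
    simp [this, unshuffleSum]
  | succ n ih =>
    rw [← Finset.univ_inter (Unshuffles (n + 1) p), ← Finset.sum_ite_mem, sum_perm_succ,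
      List.ofFn_succ, unshuffleSum]
    have hzero : ∀ i : Fin (n + 1), (i : ℕ) ≠ p → ¬ (i = 0 ∧ 0 < p) →
        (∑ τ : Equiv.Perm (Fin n), if insertPerm i τ ∈ Unshuffles (n + 1) p then
          ((Equiv.Perm.sign (insertPerm i τ) : ℤˣ) : ℤ) •
            m ((List.ofFn (a ∘ insertPerm i τ)).take p)
              ((List.ofFn (a ∘ insertPerm i τ)).drop p) else 0) = 0 := by
      refine fun i hip hi0 => Finset.sum_eq_zero fun τ _ => if_neg fun h => ?_
      rcases eq_of_insertPerm_mem_unshuffles h with h | h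
      exacts [hip h, hi0 h]
    have hright : ∀ i : Fin (n + 1), (i : ℕ) = p →
        (∑ τ : Equiv.Perm (Fin n), if insertPerm i τ ∈ Unshuffles (n + 1) p then
          ((Equiv.Perm.sign (insertPerm i τ) : ℤˣ) : ℤ) •
            m ((List.ofFn (a ∘ insertPerm i τ)).take p)
              ((List.ofFn (a ∘ insertPerm i τ)).drop p) else 0) =
          unshuffleSum (List.ofFn fun j : Fin n => a j.succ) fun s t =>
            (-1) ^ s.length * if s.length = p then m s (a 0 :: t) else 0 := by
      rintro i rfl
      rw [sum_unshuffles_insertPerm,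
        ih i (by omega) (a ∘ Fin.succ) fun s t => (-1) ^ (i : ℕ) * m s (a 0 :: t)]
      refine unshuffleSum_congr _ fun s t _ => ?_
      split_ifs with h <;> simp [h]
    rcases p with _ | p
    · rw [Fintype.sum_eq_single 0 fun i hi => hzero i (by simpa using hi) (by simp),
        hright 0 rfl]
      rw [unshuffleSum_eq_zero _ (m := fun s t => if (a 0 :: s).length = 0 then _ else _)
        (fun s t _ => by simp), zero_add]
    · have hleft := sum_unshuffles_insertPerm_zero n p a m
      rw [ih p (by omega) (a ∘ Fin.succ) fun s t => m (a 0 :: s) t] at hleft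
      rcases hp.lt_or_eq with hp | hp
      · rw [Fintype.sum_eq_add 0 ⟨p + 1, hp⟩ (by simp [Fin.ext_iff]) fun i hi =>
          hzero i (fun h => hi.2 (Fin.ext h)) fun h => hi.1 h.1, hright ⟨p + 1, hp⟩ rfl, hleft]
        simp [Function.comp_def]
      · rw [Fintype.sum_eq_single 0 fun i hi => hzero i (by omega) fun h => hi h.1, hleft]
        rw [unshuffleSum_eq_zero (List.ofFn fun i : Fin n => a i.succ)
          (m := fun s t => (-1) ^ s.length * if s.length = p + 1 then m s (a 0 :: t) else 0)]
        · simp [Function.comp_def]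
        · intro s t hst
          simp only [List.length_ofFn] at hst
          rw [if_neg (by omega), mul_zero]

end Unshuffles

/-! ### Operations as functions on lists -/

section ListOp

variable {V : Type*} [CommRing V]

/-- The function on lists given by an `n`-ary operation, extended by zero to the lists of length
other than `n`. -/
def toListOp (n : ℕ) (A : Op V) (l : List V) : V :=
  if l.length = n then A fun i => l.getD i 0 else 0

/-- The wedge product of alternating functions on lists. -/
def listWedge (f g : List V → V) (l : List V) : V :=
  unshuffleSum l fun s t => f s * g t

/-- The insertion of `g` into the first argument of `f`, summed over unshuffles. -/
def listIns (f g : List V → V) (l : List V) : V :=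
  unshuffleSum l fun s t => f (g s :: t)

/-- Additivity in the head of the list. -/
def HeadAdditive (f : List V → V) : Prop :=
  ∀ u v t, f ((u + v) :: t) = f (u :: t) + f (v :: t)

theorem HeadAdditive.zero {f : List V → V} (hf : HeadAdditive f) (t : List V) :
    f (0 :: t) = 0 := by
  simpa using hf 0 0 t

theorem HeadAdditive.unshuffleSum {f : List V → V} (hf : HeadAdditive f) (l t : List V)
    (m : List V → List V → V) :
    f (unshuffleSum l m :: t) = JacobiRevisited.unshuffleSum l fun a b => f (m a b :: t) :=
  map_unshuffleSum (AddMonoidHom.mk' (fun v => f (v :: t)) fun u v => hf u v t) l m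

theorem HeadAdditive.listWedge {f g : List V → V} (hf : HeadAdditive f) (hg : HeadAdditive g) :
    HeadAdditive (listWedge f g) := by
  intro u v t
  simp only [JacobiRevisited.listWedge, JacobiRevisited.unshuffleSum, hf u v, hg u v, add_mul,
    mul_add, unshuffleSum_add]
  ring

/-- Insertion into a wedge product. -/
theorem listIns_listWedge {p q : ℕ} {f g h : List V → V} (hf : ∀ s, s.length ≠ p → f s = 0)
    (hg : ∀ s, s.length ≠ q → g s = 0) (hh : HeadAdditive h) (l : List V) :
    listIns (listWedge g h) f l =
      listWedge (listIns g f) h l + (-1) ^ (q * (p + 1)) * listWedge g (listIns h f) l := by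
  simp only [listIns, listWedge, unshuffleSum, unshuffleSum_add, unshuffleSum_mul,
    mul_unshuffleSum]
  congr 1
  · exact (unshuffleSum_assoc l fun s a b => g (f s :: a) * h b).symm
  · rw [← unshuffleSum_assoc l fun s a b => (-1) ^ a.length * (g a * h (f s :: b))]
    simp_rw [← unshuffleSum_comm _ fun s a => (-1) ^ a.length * (g a * h (f s :: _))]
    rw [unshuffleSum_assoc l fun s a b =>
      (-1) ^ (s.length * a.length) * ((-1) ^ s.length * (g s * h (f a :: b)))]
    congr 1
    funext s t
    congr 1
    funext a b
    by_cases hs : s.length = q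
    · by_cases ha : a.length = p
      · rw [hs, ha]
        ring
      · simp [hf a ha, hh.zero]
    · simp [hg s hs]

/-- Insertion of a wedge product into a derivation. -/
theorem listIns_listWedge_of_derivation {p r : ℕ} {f g h : List V → V}
    (hf : ∀ s, s.length ≠ p → f s = 0) (hh : ∀ s, s.length ≠ r → h s = 0)
    (hadd : HeadAdditive f) (hder : ∀ u v t, f (u * v :: t) = u * f (v :: t) + v * f (u :: t))
    (l : List V) :
    listIns f (listWedge g h) l =
      (-1) ^ (r * (p + 1)) * listWedge (listIns f g) h l + listWedge g (listIns f h) l := by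
  simp only [listIns, listWedge, hadd.unshuffleSum, hder, unshuffleSum_add, unshuffleSum_mul,
    mul_unshuffleSum]
  rw [add_comm]
  congr 1
  · rw [unshuffleSum_assoc l fun s b c => h b * f (g s :: c)]
    simp_rw [← unshuffleSum_comm _ fun b c => h b * f (g _ :: c)]
    rw [← unshuffleSum_assoc l fun s b c =>
      (-1) ^ (b.length * c.length) * (h c * f (g s :: b))]
    congr 1
    funext w c
    congr 1
    funext s b
    by_cases hc : c.length = r
    · by_cases hb : b.length + 1 = p
      · rw [hc, ← hb, show r * (b.length + 1 + 1) = b.length * r + 2 * r by ring, pow_add,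
          pow_mul (-1 : V) 2]
        ring
      · simp [hf (g s :: b) (by simpa using hb)]
    · simp [hh c hc]
  · exact unshuffleSum_assoc l fun a b c => g a * f (h b :: c)

theorem toListOp_of_ne {n : ℕ} (A : Op V) {l : List V} (h : l.length ≠ n) :
    toListOp n A l = 0 :=
  if_neg h

/-- The list of the first `n` terms of a sequence. -/
def initial (n : ℕ) (x : ℕ → V) : List V := List.ofFn fun i : Fin n => x i

theorem initial_getD (l : List V) : initial l.length (fun i => l.getD i 0) = l := by
  refine List.ext_getElem (by simp [initial]) fun i h₁ h₂ => ?_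
  simp [initial]

theorem wedge_apply (nA nB : ℕ) (A B : Op V) (x : ℕ → V) :
    wedge nA nB A B x = listWedge (toListOp nA A) (toListOp nB B) (initial (nA + nB) x) := by
  have h := sum_unshuffles (nA + nB) nA (by omega) (fun i => x i)
    fun s t => toListOp nA A s * toListOp nB B t
  rw [listWedge, unshuffleSum_congr (m' := fun s t =>
    if s.length = nA then toListOp nA A s * toListOp nB B t else 0), initial, ← h]
  · refine Finset.sum_congr rfl fun σ _ => ?_
    congr 1
    simp only [toListOp, List.length_take, List.length_drop, List.length_ofFn]
    rw [if_pos (by omega), if_pos (by omega)]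
    congr 2 <;> funext i
    · by_cases hi : i < nA
      · simp [hi, List.getD_eq_getElem?_getD]
      · simp [hi, List.getD_eq_getElem?_getD]
    · by_cases hi : i < nB
      · simp [hi, List.getD_eq_getElem?_getD]
      · simp [hi, List.getD_eq_getElem?_getD]
  · intro s t _
    split_ifs with hs
    · rfl
    · rw [toListOp_of_ne A hs, zero_mul]

theorem nrIns_apply (nA nB : ℕ) (A B : Op V) (hA : HeadAdditive (toListOp nA A)) (x : ℕ → V) :
    nrIns nA nB A B x = listIns (toListOp nA A) (toListOp nB B) (initial (nA + nB - 1) x) := by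
  unfold nrIns
  split_ifs with h0
  · subst h0
    exact (unshuffleSum_eq_zero _ fun s t _ => toListOp_of_ne _ (by simp)).symm
  have h := sum_unshuffles (nA + nB - 1) nB (by omega) (fun i => x i)
    fun s t => toListOp nA A (toListOp nB B s :: t)
  rw [listIns, unshuffleSum_congr (m' := fun s t =>
    if s.length = nB then toListOp nA A (toListOp nB B s :: t) else 0), initial, ← h]
  · refine Finset.sum_congr rfl fun σ _ => ?_
    congr 1
    simp only [toListOp, List.length_take, List.length_drop, List.length_ofFn, List.length_cons]
    rw [if_pos (by omega), if_pos (by omega)]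
    congr 1
    funext j
    rcases j with _ | j
    · simp only [dite_true, List.getD_cons_zero]
      congr 1
      funext i
      by_cases hi : i < nB
      · simp [hi, List.getD_eq_getElem?_getD,
          show i < nA + nB - 1 by omega]
      · simp [hi, List.getD_eq_getElem?_getD]
    · by_cases hj : j + 1 < nA
      · simp [hj, List.getD_eq_getElem?_getD,
          show nB + j < nA + nB - 1 by omega]
      · simp [hj, List.getD_eq_getElem?_getD,
          show ¬ nB + j < nA + nB - 1 by omega]
  · intro s t _
    split_ifs with hs
    · rfl
    · rw [toListOp_of_ne B hs, hA.zero]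

theorem toListOp_wedge (nA nB : ℕ) (A B : Op V) :
    toListOp (nA + nB) (wedge nA nB A B) = listWedge (toListOp nA A) (toListOp nB B) := by
  funext l
  by_cases h : l.length = nA + nB
  · rw [toListOp, if_pos h, wedge_apply, ← h, initial_getD]
  · rw [toListOp_of_ne _ h]
    refine (unshuffleSum_eq_zero _ fun s t hst => ?_).symm
    by_cases hs : s.length = nA
    · rw [toListOp_of_ne B (by omega), mul_zero]
    · rw [toListOp_of_ne A hs, zero_mul]

theorem toListOp_nrIns {n : ℕ} (nA nB : ℕ) (A B : Op V) (hA : HeadAdditive (toListOp nA A))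
    (hn : n = nA + nB - 1) :
    toListOp n (nrIns nA nB A B) = listIns (toListOp nA A) (toListOp nB B) := by
  subst hn
  funext l
  by_cases h : l.length = nA + nB - 1
  · rw [toListOp, if_pos h, nrIns_apply _ _ _ _ hA, ← h, initial_getD]
  · rw [toListOp_of_ne _ h]
    refine (unshuffleSum_eq_zero _ fun s t hst => ?_).symm
    by_cases hs : s.length = nB
    · exact toListOp_of_ne A (by rw [List.length_cons]; omega)
    · rw [toListOp_of_ne B hs, hA.zero]

theorem neg_one_zpow_smul {e : ℤ} {n : ℕ} (h : Even (e - n)) (v : V) :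
    (((-1 : ℤˣ) ^ e : ℤˣ) : ℤ) • v = (-1) ^ n * v := by
  rw [← sub_add_cancel e n, zpow_add, h.neg_one_zpow, one_mul, zpow_natCast]
  simp

theorem ar_natCast_sub_one (n : ℕ) : ar ((n : ℤ) - 1) = n := by
  simp [ar]

theorem nrBracket_apply (p q : ℕ) {A B : Op V} (hA : HeadAdditive (toListOp p A))
    (hB : HeadAdditive (toListOp q B)) (x : ℕ → V) :
    nrBracket ((p : ℤ) - 1) ((q : ℤ) - 1) A B x =
      -listIns (toListOp q B) (toListOp p A) (initial (p + q - 1) x) +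
        (-1) ^ ((p + 1) * (q + 1)) *
          listIns (toListOp p A) (toListOp q B) (initial (p + q - 1) x) := by
  have hsign : Even (((p : ℤ) - 1) * (q - 1) - ((p + 1) * (q + 1) : ℕ)) :=
    ⟨-(p + q), by push_cast; ring⟩
  rw [nrBracket, ar_natCast_sub_one, ar_natCast_sub_one, Pi.add_apply, Pi.neg_apply,
    Pi.smul_apply, neg_one_zpow_smul hsign, nrIns_apply _ _ _ _ hA, nrIns_apply _ _ _ _ hB,
    Nat.add_comm q p]

theorem toListOp_nrBracket (p q : ℕ) {A B : Op V} (hA : HeadAdditive (toListOp p A))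
    (hB : HeadAdditive (toListOp q B)) :
    toListOp (p + q - 1) (nrBracket ((p : ℤ) - 1) ((q : ℤ) - 1) A B) = fun l =>
      -listIns (toListOp q B) (toListOp p A) l +
        (-1) ^ ((p + 1) * (q + 1)) * listIns (toListOp p A) (toListOp q B) l := by
  rw [← toListOp_nrIns (n := p + q - 1) p q A B hA rfl,
    ← toListOp_nrIns (n := p + q - 1) q p B A hB (by rw [add_comm])]
  funext l
  by_cases hl : l.length = p + q - 1
  · simp only [toListOp, if_pos hl, nrBracket_apply p q hA hB, nrIns_apply _ _ _ _ hA,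
      nrIns_apply _ _ _ _ hB, Nat.add_comm q p]
  · simp [toListOp_of_ne _ hl]

theorem listIns_eq_zero (A : Op V) (g : List V → V) (l : List V) :
    listIns (toListOp 0 A) g l = 0 :=
  unshuffleSum_eq_zero _ fun _ _ _ => toListOp_of_ne _ (by simp)

theorem listWedge_linear_left (c d : V) (f f' g : List V → V) (l : List V) :
    listWedge (fun s => c * f s + d * f' s) g l = c * listWedge f g l + d * listWedge f' g l := by
  simp only [listWedge, mul_unshuffleSum, ← unshuffleSum_add, add_mul, mul_assoc]

theorem listWedge_linear_right (c d : V) (f g g' : List V → V) (l : List V) :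
    listWedge f (fun s => c * g s + d * g' s) l = c * listWedge f g l + d * listWedge f g' l := by
  simp only [listWedge, mul_unshuffleSum, ← unshuffleSum_add, mul_add, mul_left_comm]

theorem wedge_nrBracket_left (p q r : ℕ) {A B : Op V} (C : Op V)
    (hA : HeadAdditive (toListOp p A)) (hB : HeadAdditive (toListOp q B)) (x : ℕ → V) :
    wedge (p + q - 1) r (nrBracket ((p : ℤ) - 1) ((q : ℤ) - 1) A B) C x =
      -listWedge (listIns (toListOp q B) (toListOp p A)) (toListOp r C)
          (initial (p + (q + r) - 1) x) +
        (-1) ^ ((p + 1) * (q + 1)) *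
          listWedge (listIns (toListOp p A) (toListOp q B)) (toListOp r C)
            (initial (p + (q + r) - 1) x) := by
  rw [wedge_apply, toListOp_nrBracket p q hA hB]
  by_cases h : p + q = 0
  · obtain ⟨rfl, rfl⟩ : p = 0 ∧ q = 0 := by omega
    simp only [listIns_eq_zero, listWedge, zero_mul, neg_zero, mul_zero, add_zero]
    simp [unshuffleSum_eq_zero]
  · have := listWedge_linear_left (-1) ((-1) ^ ((p + 1) * (q + 1)))
      (listIns (toListOp q B) (toListOp p A)) (listIns (toListOp p A) (toListOp q B))
      (toListOp r C) (initial (p + (q + r) - 1) x)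
    rw [show p + q - 1 + r = p + (q + r) - 1 by omega]
    simpa only [neg_one_mul] using this

theorem wedge_nrBracket_right (p q r : ℕ) {A C : Op V} (B : Op V)
    (hA : HeadAdditive (toListOp p A)) (hC : HeadAdditive (toListOp r C)) (x : ℕ → V) :
    wedge q (p + r - 1) B (nrBracket ((p : ℤ) - 1) ((r : ℤ) - 1) A C) x =
      -listWedge (toListOp q B) (listIns (toListOp r C) (toListOp p A))
          (initial (p + (q + r) - 1) x) +
        (-1) ^ ((p + 1) * (r + 1)) *
          listWedge (toListOp q B) (listIns (toListOp p A) (toListOp r C))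
            (initial (p + (q + r) - 1) x) := by
  rw [wedge_apply, toListOp_nrBracket p r hA hC]
  by_cases h : p + r = 0
  · obtain ⟨rfl, rfl⟩ : p = 0 ∧ r = 0 := by omega
    simp only [listIns_eq_zero, listWedge, neg_zero, mul_zero, add_zero]
    simp [unshuffleSum_eq_zero]
  · have := listWedge_linear_right (-1) ((-1) ^ ((p + 1) * (r + 1))) (toListOp q B)
      (listIns (toListOp r C) (toListOp p A)) (listIns (toListOp p A) (toListOp r C))
      (initial (p + (q + r) - 1) x)
    rw [show q + (p + r - 1) = p + (q + r) - 1 by omega]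
    simpa only [neg_one_mul] using this

theorem getD_cons_eq_consV (v : V) (t : List V) :
    (fun i => (v :: t).getD i 0) = consV v fun i => t.getD i 0 := by
  funext i
  rcases i with _ | i <;> simp [consV]

theorem MemADer.headAdditive {k : Type*} [CommRing k] [Algebra k V] {n : ℕ} {A : Op V}
    (hA : MemADer k ((n : ℤ) - 1) A) : HeadAdditive (toListOp n A) := by
  intro u v t
  by_cases h : t.length + 1 = n
  · have hupd : ∀ w : V, consV w (fun i => t.getD i 0) =
        Function.update (consV 0 fun i => t.getD i 0) 0 w := fun w => by
      funext i
      rcases i with _ | i <;> simp [consV]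
    have := ((hA.1.2 0 (by rw [ar_natCast_sub_one]; omega)).2
      (consV 0 fun i => t.getD i 0) u v)
    rw [← hupd, ← hupd, ← hupd] at this
    simp only [toListOp, List.length_cons, if_pos h, getD_cons_eq_consV, this]
  · simp [toListOp, h]

theorem MemADer.toListOp_mul_cons {k : Type*} [CommRing k] [Algebra k V] {n : ℕ} {A : Op V}
    (hA : MemADer k ((n : ℤ) - 1) A) (u v : V) (t : List V) :
    toListOp n A (u * v :: t) = u * toListOp n A (v :: t) + v * toListOp n A (u :: t) := by
  by_cases h : t.length + 1 = n
  · simp only [toListOp, List.length_cons, if_pos h, getD_cons_eq_consV,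
      hA.2.2 (by omega) u v]
  · simp [toListOp, h]

end ListOp


/-- `(ADer(V), ∧, [·,·]^{NR})` is a Gerstenhaber algebra: the
graded Leibniz rule `[X,Y∧Z] = [X,Y]∧Z + (−1)^{x(y+1)} Y∧[X,Z]` holds for
multiderivations. -/
theorem statement8 (k V : Type*) [Field k] [CharZero k]
    [CommRing V] [Algebra k V]
    (x y z : ℤ) (hx : -1 ≤ x) (hy : -1 ≤ y) (hz : -1 ≤ z)
    (X Y Z : Op V) (hX : MemADer k x X) (hY : MemADer k y Y) (hZ : MemADer k z Z) :
    nrBracket x (y + z + 1) X (wedge (ar y) (ar z) Y Z) =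
      wedge (ar (x + y)) (ar z) (nrBracket x y X Y) Z +
        (((-1 : ℤˣ) ^ (x * (y + 1)) : ℤˣ) : ℤ) •
          wedge (ar y) (ar (x + z)) Y (nrBracket x z X Z) := by
  obtain ⟨p, rfl⟩ : ∃ p : ℕ, x = p - 1 := ⟨(x + 1).toNat, by omega⟩
  obtain ⟨q, rfl⟩ : ∃ q : ℕ, y = q - 1 := ⟨(y + 1).toNat, by omega⟩
  obtain ⟨r, rfl⟩ : ∃ r : ℕ, z = r - 1 := ⟨(z + 1).toNat, by omega⟩
  have har : ∀ s : ℕ, ar ((p : ℤ) - 1 + (s - 1)) = p + s - 1 := fun s => by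
    simp only [ar]
    omega
  have hYZ := hY.headAdditive.listWedge hZ.headAdditive
  have hsign : Even (((p : ℤ) - 1) * (q - 1 + 1) - ((p + 1) * q : ℕ)) :=
    ⟨-q, by push_cast; ring⟩
  funext u
  have hLHS := nrBracket_apply p (q + r) (B := wedge q r Y Z) hX.headAdditive
    (by rwa [toListOp_wedge]) u
  rw [toListOp_wedge, listIns_listWedge (fun _ => toListOp_of_ne X) (fun _ => toListOp_of_ne Y)
    hZ.headAdditive, listIns_listWedge_of_derivation (fun _ => toListOp_of_ne X)
    (fun _ => toListOp_of_ne Z) hX.headAdditive hX.toListOp_mul_cons] at hLHS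
  rw [har, har, ar_natCast_sub_one, ar_natCast_sub_one, Pi.add_apply, Pi.smul_apply,
    neg_one_zpow_smul hsign, wedge_nrBracket_left p q r Z hX.headAdditive hY.headAdditive,
    wedge_nrBracket_right p q r Y hX.headAdditive hZ.headAdditive,
    show (q : ℤ) - 1 + (r - 1) + 1 = ((q + r : ℕ) : ℤ) - 1 by push_cast; ring, hLHS]
  have hsq : ((-1 : V) ^ (r * (p + 1))) ^ 2 = 1 := by
    rw [← pow_mul, mul_comm, pow_mul, neg_one_sq, one_pow]
  have hL : (-1 : V) ^ ((p + 1) * (q + 1)) =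
      (-1) ^ ((p + 1) * (q + r + 1)) * (-1) ^ (r * (p + 1)) := by
    rw [show (p + 1) * (q + r + 1) = (p + 1) * (q + 1) + r * (p + 1) by ring, pow_add, mul_assoc,
      ← sq, hsq, mul_one]
  have hR : (-1 : V) ^ ((p + 1) * (q + r + 1)) =
      (-1) ^ ((p + 1) * q) * (-1) ^ ((p + 1) * (r + 1)) := by
    rw [← pow_add]
    ring_nf
  rw [hL, mul_comm q (p + 1), hR]
  ring

end JacobiRevisited
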